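/- Let k be an algebraically closed field of characteristic zero. Let A' = k_{−1}[u^{±1}, v^{±1}] and A'' = A'[(u²−v²)^{−1}], and let S_2 = ⟨h⟩ act by h·u = v, h·v = u. Then the skew group ring T'' = A'' # S_2 is an Azumaya algebra. -/

import Mathlib

/-- `T` together with `ι : A →+* T` and `j : G → T` is the skew group ring `A # G`
for the action of the finite group `G` on `A`. -/
structure IsSkewGroupRing (A : Type*) [Ring A] (G : Type*) [Group G] [Fintype G]
    [MulSemiringAction G A] (T : Type*) [Ring T] (ι : A →+* T) (j : G → T) : Prop where
  injective : Function.Injective ι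
  j_one : j 1 = 1
  j_mul : ∀ g h : G, j g * j h = j (g * h)
  comm : ∀ (g : G) (a : A), j g * ι a = ι (g • a) * j g
  basis : ∀ t : T, ∃! c : G → A, t = ∑ g : G, ι (c g) * j g

/-- The natural map `A ⊗_{Z(A)} Aᵐᵒᵖ →ₗ End_{Z(A)}(A)`, `a ⊗ b ↦ (r ↦ a * r * b)`. -/
noncomputable def azumayaMulMap (A : Type*) [Ring A] :
    TensorProduct (Subring.center A) A Aᵐᵒᵖ →ₗ[Subring.center A]
      (A →ₗ[Subring.center A] A) :=
  TensorProduct.lift (LinearMap.mk₂ (Subring.center A)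
    (fun a b =>
      { toFun := fun r => a * r * b.unop
        map_add' := fun x y => by simp [mul_add, add_mul]
        map_smul' := fun z x => by
          have hz := Subring.mem_center_iff.mp z.2
          show a * ((z : A) * x) * b.unop = (z : A) * (a * x * b.unop)
          simp only [← mul_assoc]
          rw [hz a] })
    (fun a a' b => by ext r; simp [add_mul])
    (fun z a b => by
      ext r
      have hz := Subring.mem_center_iff.mp z.2
      show ((z : A) * a) * r * b.unop = (z : A) * (a * r * b.unop)
      simp [mul_assoc])
    (fun a b b' => by ext r; simp [mul_add])
    (fun z a b => by
      ext r
      have hz := Subring.mem_center_iff.mp z.2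
      show a * r * ((z : A) • b).unop = (z : A) * (a * r * b.unop)
      rw [MulOpposite.unop_smul]
      show a * r * ((z : A) * b.unop) = (z : A) * (a * r * b.unop)
      rw [← mul_assoc, hz (a * r), mul_assoc]))

/-- A ring is an *Azumaya algebra* (over its centre `Z`) if it is a finitely generated
projective `Z`-module and the natural map `A ⊗_Z Aᵐᵒᵖ → End_Z(A)` is bijective. -/
def IsAzumayaAlgebra (A : Type*) [Ring A] : Prop :=
  Module.Finite (Subring.center A) A ∧ Module.Projective (Subring.center A) A ∧
    Function.Bijective (azumayaMulMap A)

/-- `f : A →+* B` exhibits `B` as the (right) Ore localization of `A` at the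
submonoid `S`. -/
structure IsOreLocalization {A B : Type*} [Ring A] [Ring B] (S : Submonoid A)
    (f : A →+* B) : Prop where
  isUnit : ∀ s ∈ S, IsUnit (f s)
  num_den : ∀ b : B, ∃ a : A, ∃ s ∈ S, b * f s = f a
  ker : ∀ a : A, f a = 0 → ∃ s ∈ S, a * s = 0

/-- The relation defining the quantum plane `K_q[u,v]`: `v u = q · u v`. -/
inductive QuantumRel (K : Type*) [CommRing K] (q : K) :
    FreeAlgebra K (Fin 2) → FreeAlgebra K (Fin 2) → Prop
  | rel : QuantumRel K q (FreeAlgebra.ι K 1 * FreeAlgebra.ι K 0)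
      (q • (FreeAlgebra.ι K 0 * FreeAlgebra.ι K 1))

/-- The quantum plane `K_q[u,v] = K⟨u,v⟩/(vu - q·uv)`. -/
abbrev QuantumPlane (K : Type*) [CommRing K] (q : K) := RingQuot (QuantumRel K q)

/-- The generator `u` of the quantum plane. -/
noncomputable def qU (K : Type*) [CommRing K] (q : K) : QuantumPlane K q :=
  RingQuot.mkAlgHom K (QuantumRel K q) (FreeAlgebra.ι K 0)

/-- The generator `v` of the quantum plane. -/
noncomputable def qV (K : Type*) [CommRing K] (q : K) : QuantumPlane K q :=
  RingQuot.mkAlgHom K (QuantumRel K q) (FreeAlgebra.ι K 1)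

open TensorProduct MulOpposite

theorem azumayaMulMap_eq_mulLeftRight (T : Type*) [Ring T] (E : T ⊗[Subring.center T] Tᵐᵒᵖ) :
    azumayaMulMap T E = AlgHom.mulLeftRight (Subring.center T) T E := by
  induction E with
  | zero => rw [map_zero, map_zero]
  | add x y hx hy => rw [map_add, map_add, hx, hy]
  | tmul a b =>
    ext r
    rw [AlgHom.mulLeftRight_apply]
    rfl

/-- Every element of `B` is the sum of the `φ i r * x i`, where the `φ i` are maps of the form
`r ↦ ∑ p * r * q` sending `B` into `C`. -/
def HasInnerDualBasis {T : Type*} [Ring T] (B C : Set T) : Prop :=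
  ∃ (κ : Type) (_ : Fintype κ) (E : κ → T ⊗[Subring.center T] Tᵐᵒᵖ) (x : κ → T),
    ∀ r ∈ B, (∀ i, AlgHom.mulLeftRight (Subring.center T) T (E i) r ∈ C) ∧
      ∑ i, AlgHom.mulLeftRight (Subring.center T) T (E i) r * x i = r

theorem HasInnerDualBasis.trans {T : Type*} [Ring T] {B C D : Set T}
    (hBC : HasInnerDualBasis B C) (hCD : HasInnerDualBasis C D) : HasInnerDualBasis B D := by
  obtain ⟨κ, _, E, x, hE⟩ := hBC
  obtain ⟨l, _, F, y, hF⟩ := hCD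
  refine ⟨κ × l, inferInstance, fun i => F i.2 * E i.1, fun i => y i.2 * x i.1, fun r hr => ?_⟩
  obtain ⟨h₁, h₂⟩ := hE r hr
  refine ⟨fun i => ?_, ?_⟩
  · rw [map_mul, Module.End.mul_apply]
    exact (hF _ (h₁ _)).1 _
  · simp only [map_mul, Module.End.mul_apply, Fintype.sum_prod_type, ← mul_assoc,
      ← Finset.sum_mul, (hF _ (h₁ _)).2, h₂]

theorem HasInnerDualBasis.isAzumayaAlgebra {T : Type*} [Ring T]
    (hT : HasInnerDualBasis Set.univ (Subring.center T : Set T)) : IsAzumayaAlgebra T := by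
  obtain ⟨κ, _, E, x, hE⟩ := hT
  have hZ : ∀ i r, AlgHom.mulLeftRight (Subring.center T) T (E i) r ∈ Subring.center T :=
    fun i r => (hE r trivial).1 i
  have hx : ∀ r, ∑ i, AlgHom.mulLeftRight (Subring.center T) T (E i) r * x i = r :=
    fun r => (hE r trivial).2
  let φ : κ → T →ₗ[Subring.center T] Subring.center T := fun i =>
    { toFun := fun r => ⟨_, hZ i r⟩
      map_add' := fun a b => Subtype.ext (map_add _ a b)
      map_smul' := fun a b => Subtype.ext (map_smul _ a b) }
  have hφ : ∀ i r, ((φ i r : Subring.center T) : T) =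
      AlgHom.mulLeftRight (Subring.center T) T (E i) r := fun _ _ => rfl
  have hφx : ∀ r, ∑ i, φ i r • x i = r := hx
  have hcomp : Fintype.linearCombination (Subring.center T) x ∘ₗ LinearMap.pi φ =
      LinearMap.id := by
    ext r
    simpa [Fintype.linearCombination_apply] using hφx r
  refine ⟨?_, Module.Projective.of_split _ _ hcomp, ?_, ?_⟩
  · refine Module.Finite.of_surjective (Fintype.linearCombination (Subring.center T) x)
      fun r => ⟨LinearMap.pi φ r, LinearMap.congr_fun hcomp r⟩
  · rw [← LinearMap.ker_eq_bot, LinearMap.ker_eq_bot']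
    intro w hw
    let Ψ : (T →ₗ[Subring.center T] T) → (T ⊗[Subring.center T] Tᵐᵒᵖ →ₗ[Subring.center T] T) :=
      fun f => LinearMap.mul' (Subring.center T) T ∘ₗ
        TensorProduct.map f (opLinearEquiv (Subring.center T)).symm.toLinearMap
    have hΨ : ∀ f p q, Ψ f (p ⊗ₜ q) = f p * q.unop := fun f p q => by simp [Ψ]
    have hΨ_add : ∀ f g F, Ψ (f + g) F = Ψ f F + Ψ g F := fun f g F => by
      simp [Ψ, TensorProduct.map_add_left]
    have hΨ_zero : ∀ F, Ψ 0 F = 0 := fun F => by simp [Ψ]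
    have key : w = ∑ i, Ψ (azumayaMulMap T w) (E i) ⊗ₜ op (x i) := by
      clear hw
      induction w with
      | zero => simp [hΨ_zero]
      | add w₁ w₂ h₁ h₂ =>
        simp only [map_add, hΨ_add, TensorProduct.add_tmul, Finset.sum_add_distrib]
        rw [← h₁, ← h₂]
      | tmul a b =>
        have h₁ : ∀ F, Ψ (azumayaMulMap T (a ⊗ₜ b)) F =
            a * AlgHom.mulLeftRight (Subring.center T) T F b.unop := fun F => by
          induction F with
          | zero => simp
          | add x y hx hy => rw [map_add, hx, hy, map_add, LinearMap.add_apply, mul_add]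
          | tmul p q =>
            rw [hΨ, azumayaMulMap_eq_mulLeftRight, AlgHom.mulLeftRight_apply,
              AlgHom.mulLeftRight_apply]
            simp only [mul_assoc]
        have h₂ : ∀ i, Ψ (azumayaMulMap T (a ⊗ₜ b)) (E i) = φ i b.unop • a := fun i => by
          rw [h₁, ← hφ]
          exact Subring.mem_center_iff.mp (φ i b.unop).2 a
        simp only [h₂, TensorProduct.smul_tmul, ← TensorProduct.tmul_sum]
        congr 1
        apply unop_injective
        simpa using (hφx b.unop).symm
    rw [key, hw]
    simp [hΨ_zero]
  · intro f
    refine ⟨∑ i, (f (x i) ⊗ₜ 1) * E i, ?_⟩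
    ext r
    rw [azumayaMulMap_eq_mulLeftRight]
    conv_rhs => rw [← hφx r]
    simp only [map_sum, map_mul, LinearMap.sum_apply, Module.End.mul_apply, map_smul,
      AlgHom.mulLeftRight_apply, unop_one, mul_one]
    refine Finset.sum_congr rfl fun i _ => ?_
    rw [← hφ]
    exact Subring.mem_center_iff.mp (φ i r).2 _

theorem mul_comm_of_two_mul_eq_one {T : Type*} [Ring T] {c : T} (hc : 2 * c = 1) (t : T) :
    t * c = c * t := by
  have h₁ : c * 2 = 1 := by rw [mul_two, ← two_mul, hc]
  calc t * c = (c * 2) * (t * c) := by rw [h₁, one_mul]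
    _ = c * (t * (2 * c)) := by simp only [two_mul, mul_two, mul_add, add_mul]
    _ = c * t := by rw [hc, mul_one]

/-- If the unit `d` centralises `R` and anticommutes with the involution `h`, then `R + R * h`
has an inner dual basis over `R`. -/
theorem hasInnerDualBasis_of_anticommute {T : Type*} [Ring T] (R : Subring T) (c h : T) (d : Tˣ)
    (hc : 2 * c = 1) (hdR : ∀ a ∈ R, a * d = d * a) (hh : h * h = 1) (hhd : h * d = -(d * h))
    (hT : ∀ t : T, ∃ a ∈ R, ∃ b ∈ R, t = a + b * h) :
    HasInnerDualBasis Set.univ (R : Set T) := by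
  have key : ∀ a ∈ R, ∀ b ∈ R, c * ((a + b * h) + ↑d⁻¹ * (a + b * h) * d) = a := by
    intro a ha b hb
    have h₁ : ↑d⁻¹ * (a + b * h) * d = a - b * h := by
      rw [mul_assoc, Units.inv_mul_eq_iff_eq_mul, add_mul, mul_assoc b, hhd, mul_sub, hdR a ha,
        mul_neg, ← mul_assoc b, hdR b hb, mul_assoc, sub_eq_add_neg]
    rw [h₁, add_add_sub_cancel, ← two_mul, ← mul_assoc, mul_comm_of_two_mul_eq_one hc 2 |>.symm,
      hc, one_mul]
  let E : T ⊗[Subring.center T] Tᵐᵒᵖ := (c ⊗ₜ 1) * (1 + (↑d⁻¹ : T) ⊗ₜ op (d : T))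
  have hE : ∀ r, AlgHom.mulLeftRight (Subring.center T) T E r = c * (r + ↑d⁻¹ * r * d) := by
    intro r
    simp [E]
  refine ⟨Fin 2, inferInstance, ![E, E * (1 ⊗ₜ op h)], ![1, h], fun r _ => ?_⟩
  obtain ⟨a, ha, b, hb, rfl⟩ := hT r
  have h₀ : AlgHom.mulLeftRight (Subring.center T) T E (a + b * h) = a := by
    rw [hE, key a ha b hb]
  have h₁ : AlgHom.mulLeftRight (Subring.center T) T (E * (1 ⊗ₜ op h)) (a + b * h) = b := by
    rw [map_mul, Module.End.mul_apply, AlgHom.mulLeftRight_apply, one_mul, unop_op, hE,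
      add_mul, mul_assoc b, hh, mul_one, add_comm (a * h), key b hb a ha]
  refine ⟨fun i => ?_, ?_⟩
  · fin_cases i
    · exact h₀.symm ▸ ha
    · exact h₁.symm ▸ hb
  · simp only [Fin.sum_univ_two, Matrix.cons_val_zero, Matrix.cons_val_one, h₀, h₁, mul_one]

/-- If `u` and `v` are anticommuting units of `R` whose squares are central in `R`, and the elements
of `R` commuting with both are central in `R`, then `R` has an inner dual basis over its centre. -/
theorem hasInnerDualBasis_of_anticommuting_units {T : Type*} [Ring T] (R : Subring T) (c : T)
    (u v : Tˣ) (hc : 2 * c = 1) (hcR : c ∈ R) (hu : (u : T) ∈ R) (hu' : (↑u⁻¹ : T) ∈ R)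
    (hv : (v : T) ∈ R) (hv' : (↑v⁻¹ : T) ∈ R) (huv : (v * u : T) = -(u * v))
    (hu2 : ∀ a ∈ R, (u * (u * a) : T) = a * (u * u)) (hv2 : ∀ a ∈ R, (v * (v * a) : T) = a * (v * v))
    (hR : ∀ x ∈ R, u * x = x * u → v * x = x * v → ∀ a ∈ R, a * x = x * a) :
    HasInnerDualBasis (R : Set T) {x | x ∈ R ∧ ∀ a ∈ R, a * x = x * a} := by
  let w : Fin 4 → Tˣ := ![1, u, v, u * v]
  let F : T ⊗[Subring.center T] Tᵐᵒᵖ := ∑ i, (w i : T) ⊗ₜ op (↑(w i)⁻¹ : T)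
  have hF : ∀ r, AlgHom.mulLeftRight (Subring.center T) T F r =
      r + u * r * ↑u⁻¹ + v * r * ↑v⁻¹ + u * v * r * (↑v⁻¹ * ↑u⁻¹) := by
    intro r
    simp [F, w, Fin.sum_univ_four]
  have comm_c := mul_comm_of_two_mul_eq_one hc
  have huv' : (v * ↑u⁻¹ : T) = -(↑u⁻¹ * v) := by
    rw [← Units.mul_left_inj u, ← Units.mul_right_inj u]
    simp [mul_assoc, huv]
  have hu'v : (↑v⁻¹ * u : T) = -(u * ↑v⁻¹) := by
    rw [← Units.mul_left_inj v, ← Units.mul_right_inj v]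
    simp [mul_assoc, huv]
  have hu'v' : (↑v⁻¹ * ↑u⁻¹ : T) = -(↑u⁻¹ * ↑v⁻¹) := by
    rw [← Units.mul_left_inj v, ← Units.mul_right_inj v]
    simp [mul_assoc, huv']
  have huv_assoc : ∀ z : T, v * (u * z) = -(u * (v * z)) := fun z => by
    rw [← mul_assoc, huv, neg_mul, mul_assoc]
  have huv'_assoc : ∀ z : T, v * (↑u⁻¹ * z) = -(↑u⁻¹ * (v * z)) := fun z => by
    rw [← mul_assoc, huv', neg_mul, mul_assoc]
  have hu'v_assoc : ∀ z : T, ↑v⁻¹ * (u * z) = -(u * (↑v⁻¹ * z)) := fun z => by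
    rw [← mul_assoc, hu'v, neg_mul, mul_assoc]
  have hu'v'_assoc : ∀ z : T, ↑v⁻¹ * (↑u⁻¹ * z) = -(↑u⁻¹ * (↑v⁻¹ * z)) := fun z => by
    rw [← mul_assoc, hu'v', neg_mul, mul_assoc]
  refine ⟨Fin 4, inferInstance, fun i => ((c * c) ⊗ₜ 1) * F * (1 ⊗ₜ op (↑(w i)⁻¹ : T)),
    fun i => w i, fun r hr => ⟨fun i => ?_, ?_⟩⟩
  · have hq : r * (↑(w i)⁻¹ : T) ∈ R := by
      refine R.mul_mem hr ?_
      fin_cases i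
      · simp [w, R.one_mem]
      · exact hu'
      · exact hv'
      · simpa [w] using R.mul_mem hv' hu'
    rw [map_mul, map_mul, Module.End.mul_apply, Module.End.mul_apply, AlgHom.mulLeftRight_apply,
      AlgHom.mulLeftRight_apply, hF, one_mul, unop_op, unop_one, mul_one]
    generalize r * (↑(w i)⁻¹ : T) = q at hq
    set τ := q + u * q * ↑u⁻¹ + v * q * ↑v⁻¹ + u * v * q * (↑v⁻¹ * ↑u⁻¹) with hτ
    have hτR : τ ∈ R := by
      refine R.add_mem (R.add_mem (R.add_mem hq ?_) ?_) ?_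
      · exact R.mul_mem (R.mul_mem hu hq) hu'
      · exact R.mul_mem (R.mul_mem hv hq) hv'
      · exact R.mul_mem (R.mul_mem (R.mul_mem hu hv) hq) (R.mul_mem hv' hu')
    have hu2_assoc : ∀ z : T, u * (u * (q * z)) = q * (u * (u * z)) := fun z => by
      simpa only [mul_assoc] using congr_arg (· * z) (hu2 q hq)
    have hv2_assoc : ∀ z : T, v * (v * (q * z)) = q * (v * (v * z)) := fun z => by
      simpa only [mul_assoc] using congr_arg (· * z) (hv2 q hq)
    have hu2_v_assoc : ∀ z : T, u * (u * (v * (q * z))) = v * (q * (u * (u * z))) := fun z => by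
      simpa only [mul_assoc] using congr_arg (· * z) (hu2 (v * q) (R.mul_mem hv hq))
    have hτu : u * τ = τ * u := by
      simp only [hτ, mul_add, add_mul, mul_assoc, hu'v', hu2_assoc, hu2_v_assoc, mul_neg,
        neg_mul, Units.mul_inv, Units.inv_mul, mul_one, hu'v, Units.mul_inv_cancel_left,
        Units.inv_mul_cancel_left]
      abel
    have hτv : v * τ = τ * v := by
      simp only [hτ, mul_add, add_mul, mul_assoc, huv', hu'v', hv2_assoc, huv_assoc, mul_neg,
        neg_mul, Units.mul_inv, Units.inv_mul, mul_one, huv'_assoc]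
      abel
    refine ⟨R.mul_mem (R.mul_mem hcR hcR) hτR, fun a ha => ?_⟩
    rw [← mul_assoc a, ← mul_assoc a, comm_c, mul_assoc c, comm_c, mul_assoc, mul_assoc, mul_assoc,
      hR τ hτR hτu hτv a ha]
  · simp only [map_mul, Module.End.mul_apply, AlgHom.mulLeftRight_apply, hF, mul_assoc,
      ← Finset.mul_sum, unop_op, unop_one, mul_one, one_mul]
    have h₁ : c * c * 4 = 1 := by
      rw [show (4 : T) = 2 * 2 by norm_num, mul_assoc c, ← mul_assoc c 2, ← comm_c 2, hc, one_mul,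
        ← comm_c 2, hc]
    rw [← mul_assoc c c]
    trans c * c * (4 * r)
    · congr 1
      simp only [Fin.sum_univ_four, w, Matrix.cons_val_zero, Matrix.cons_val_one, Matrix.cons_val,
        inv_one, Units.val_one, mul_inv_rev, Units.val_mul, mul_assoc, add_mul, mul_neg,
        hu'v, hu'v', hu'v_assoc, hu'v'_assoc, Units.inv_mul_cancel_left, Units.inv_mul, neg_mul,
        mul_one, one_mul, neg_neg]
      rw [show (4 : T) = 1 + 1 + 1 + 1 by norm_num]
      simp only [add_mul, one_mul]
      abel
    · rw [← mul_assoc, h₁, one_mul]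

/-- If conjugation by the involution `h` preserves `R` and negates a unit `d` centralising `R`, then
the centre of `R` has an inner dual basis over the centre of `R + R * h`. -/
theorem hasInnerDualBasis_center_of_anticommute {T : Type*} [Ring T] (R : Subring T) (c h : T)
    (d : Tˣ) (hc : 2 * c = 1)
    (hdR : ∀ a ∈ R, a * d = d * a) (hh : h * h = 1) (hhd : h * d = -(d * h))
    (hR : ∀ a ∈ R, h * a * h ∈ R) (hT : ∀ t : T, ∃ a ∈ R, ∃ b ∈ R, t = a + b * h) :
    HasInnerDualBasis {x | x ∈ R ∧ ∀ a ∈ R, a * x = x * a} (Subring.center T : Set T) := by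
  have comm_c := mul_comm_of_two_mul_eq_one hc
  have hh_assoc : ∀ z, h * (h * z) = z := fun z => by rw [← mul_assoc, hh, one_mul]
  have key : ∀ x, (∀ a ∈ R, a * x = x * a) → c * (x + h * x * h) ∈ Subring.center T := by
    intro x hx
    refine Subring.mul_mem _ (Subring.mem_center_iff.mpr comm_c) (Subring.mem_center_iff.mpr ?_)
    have comm_h : h * (x + h * x * h) = (x + h * x * h) * h := by
      simp only [mul_add, add_mul, mul_assoc, hh, hh_assoc, mul_one, add_comm]
    have comm_R : ∀ a ∈ R, a * (x + h * x * h) = (x + h * x * h) * a := by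
      intro a ha
      have h₁ : a * (h * x * h) = h * x * h * a :=
        calc a * (h * x * h) = h * ((h * a * h) * x) * h := by simp only [mul_assoc, hh_assoc]
          _ = h * x * h * a := by rw [hx _ (hR a ha)]; simp only [mul_assoc, hh, mul_one]
      rw [mul_add, add_mul, hx a ha, h₁]
    intro t
    obtain ⟨a, ha, b, hb, rfl⟩ := hT t
    generalize x + h * x * h = y at comm_h comm_R
    rw [add_mul, mul_add, comm_R a ha, mul_assoc b, comm_h, ← mul_assoc b, comm_R b hb, mul_assoc]
  let E : T ⊗[Subring.center T] Tᵐᵒᵖ := (c ⊗ₜ 1) * (1 + h ⊗ₜ op h)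
  have hE : ∀ r, AlgHom.mulLeftRight (Subring.center T) T E r = c * (r + h * r * h) := by
    intro r
    simp [E]
  have hE' : ∀ r, AlgHom.mulLeftRight (Subring.center T) T (E * (1 ⊗ₜ op (↑d⁻¹ : T))) r =
      c * (r * ↑d⁻¹ + h * (r * ↑d⁻¹) * h) := by
    intro r
    rw [map_mul, Module.End.mul_apply, AlgHom.mulLeftRight_apply, one_mul, unop_op, hE]
  refine ⟨Fin 2, inferInstance, ![E, E * (1 ⊗ₜ op (↑d⁻¹ : T))], ![1, (d : T)],
    fun r hr => ⟨fun i => ?_, ?_⟩⟩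
  · fin_cases i
    · exact (hE r).symm ▸ key r hr.2
    · refine (hE' r).symm ▸ key _ fun a ha => ?_
      have h₁ : a * (↑d⁻¹ : T) = ↑d⁻¹ * a := by
        rw [Units.eq_inv_mul_iff_mul_eq, ← mul_assoc, ← hdR a ha, mul_assoc, Units.mul_inv,
          mul_one]
      rw [← mul_assoc, hr.2 a ha, mul_assoc, mul_assoc, h₁]
  · have h₁ : (r * ↑d⁻¹ + h * (r * ↑d⁻¹) * h) * d = r - h * r * h := by
      simp only [add_mul, mul_assoc, hhd, Units.inv_mul, mul_one, mul_neg,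
        Units.inv_mul_cancel_left, sub_eq_add_neg]
    simp only [Fin.sum_univ_two, Matrix.cons_val_zero, Matrix.cons_val_one, hE, hE', mul_one]
    rw [mul_assoc c, h₁, ← mul_add, add_add_sub_cancel, ← mul_two, ← mul_assoc, ← comm_c,
      mul_assoc, ← comm_c, hc, mul_one]

theorem qV_mul_qU (K : Type*) [CommRing K] (q : K) : qV K q * qU K q = q • (qU K q * qV K q) := by
  simpa [qU, qV] using RingQuot.mkAlgHom_rel K (QuantumRel.rel (K := K) (q := q))

theorem QuantumPlane.induction_on {K : Type*} [CommRing K] {q : K} {P : QuantumPlane K q → Prop}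
    (p : QuantumPlane K q) (h_scalar : ∀ r : K, P (algebraMap K _ r)) (hu : P (qU K q))
    (hv : P (qV K q)) (h_mul : ∀ a b, P a → P b → P (a * b)) (h_add : ∀ a b, P a → P b → P (a + b)) :
    P p := by
  obtain ⟨x, rfl⟩ := RingQuot.mkAlgHom_surjective K (QuantumRel K q) p
  induction x with
  | grade0 r => simpa using h_scalar r
  | grade1 i =>
    fin_cases i
    · exact hu
    · exact hv
  | mul a b ha hb => rw [map_mul]; exact h_mul _ _ ha hb
  | add a b ha hb => rw [map_add]; exact h_add _ _ ha hb

theorem IsOreLocalization.comm_of_forall_comm {A B : Type*} [Ring A] [Ring B] {S : Submonoid A}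
    {f : A →+* B} (hf : IsOreLocalization S f) {c : B} (hc : ∀ a, f a * c = c * f a) (b : B) :
    b * c = c * b := by
  obtain ⟨a, s, hs, hb⟩ := hf.num_den b
  rw [← (hf.isUnit s hs).mul_left_inj, mul_assoc, ← hc, ← mul_assoc, hb, hc, mul_assoc, hb]

theorem IsOreLocalization.comm_of_comm_generators {K B : Type*} [CommRing K] {q : K} [Ring B]
    {S : Submonoid (QuantumPlane K q)} {f : QuantumPlane K q →+* B} (hf : IsOreLocalization S f)
    {c : B} (hu : f (qU K q) * c = c * f (qU K q)) (hv : f (qV K q) * c = c * f (qV K q)) (b : B) :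
    b * c = c * b := by
  refine hf.comm_of_forall_comm (fun p => ?_) b
  induction p using QuantumPlane.induction_on with
  | h_scalar r =>
    refine (hf.comm_of_forall_comm (fun a => ?_) c).symm
    rw [← map_mul, ← map_mul, Algebra.commutes]
  | hu => exact hu
  | hv => exact hv
  | h_mul x y hx hy => rw [map_mul, mul_assoc, hy, ← mul_assoc, hx, mul_assoc]
  | h_add x y hx hy => rw [map_add, add_mul, hx, hy, mul_add]

/-- The skew group ring `k_{-1}[u^{±1},v^{±1}][(u²-v²)⁻¹] # S₂` is Azumaya. -/
theorem localizedMinusOnePlane_S2_skewGroupRing_azumaya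
    (k : Type) [Field k] [IsAlgClosed k] [CharZero k]
    (G : Type) [Group G] [Fintype G] (h : G)
    (hord : orderOf h = 2) (hG : ∀ x : G, x = 1 ∨ x = h)
    [MulSemiringAction G (QuantumPlane k (-1 : k))]
    [SMulCommClass G k (QuantumPlane k (-1 : k))]
    (hu : h • qU k (-1 : k) = qV k (-1 : k)) (hv : h • qV k (-1 : k) = qU k (-1 : k))
    (A'' : Type) [Ring A''] (f : QuantumPlane k (-1 : k) →+* A'')
    (hloc : IsOreLocalization
      (Submonoid.closure
        {qU k (-1 : k), qV k (-1 : k), qU k (-1 : k) ^ 2 - qV k (-1 : k) ^ 2}) f)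
    [MulSemiringAction G A'']
    (hequi : ∀ (x : G) (a : QuantumPlane k (-1 : k)), x • f a = f (x • a))
    (T'' : Type) [Ring T''] (iota : A'' →+* T'') (j : G → T'')
    (hT : IsSkewGroupRing A'' G T'' iota j) :
    IsAzumayaAlgebra T'' := by
  have huv : f (qV k (-1)) * f (qU k (-1)) = -(f (qU k (-1)) * f (qV k (-1))) := by
    rw [← map_mul, qV_mul_qU, Algebra.smul_def, map_mul, map_neg, map_neg, map_one, map_one,
      neg_one_mul, map_mul]
  have h_one : h ≠ 1 := fun h_eq => by simp [h_eq] at hord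
  have hh : j h * j h = 1 := by
    rw [hT.j_mul, ← pow_two, ← hord, pow_orderOf_eq_one, hT.j_one]
  classical
  have h_univ : (Finset.univ : Finset G) = {1, h} := by
    ext x
    simpa using hG x
  have h_decomp : ∀ t : T'', ∃ a ∈ iota.range, ∃ b ∈ iota.range, t = a + b * j h := fun t => by
    obtain ⟨c, hc, -⟩ := hT.basis t
    refine ⟨_, ⟨c 1, rfl⟩, _, ⟨c h, rfl⟩, ?_⟩
    rw [hc, h_univ, Finset.sum_pair h_one.symm, hT.j_one, mul_one]
  have h_conj : ∀ a ∈ iota.range, j h * a * j h ∈ iota.range := by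
    rintro _ ⟨a, rfl⟩
    exact ⟨h • a, by rw [hT.comm, mul_assoc, hh, mul_one]⟩
  obtain ⟨u, hu_eq⟩ := hloc.isUnit _ (Submonoid.subset_closure (Or.inl rfl))
  obtain ⟨v, hv_eq⟩ := hloc.isUnit _ (Submonoid.subset_closure (Or.inr (Or.inl rfl)))
  obtain ⟨d, hd_eq⟩ := hloc.isUnit _ (Submonoid.subset_closure (Or.inr (Or.inr rfl)))
  have hd_sq : (d : A'') = u * u - v * v := by
    rw [hd_eq, map_sub, map_pow, map_pow, hu_eq, hv_eq, pow_two, pow_two]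
  rw [← hu_eq, ← hv_eq] at huv
  have h_center : ∀ c : A'', u * c = c * u → v * c = c * v → ∀ b, b * c = c * b :=
    fun c hcu hcv => hloc.comm_of_comm_generators (hu_eq ▸ hcu) (hv_eq ▸ hcv)
  have hu2 : ∀ a : A'', a * (u * u) = u * u * a := h_center _ (mul_assoc _ _ _).symm <| by
    rw [← mul_assoc, huv, neg_mul, mul_assoc, huv, mul_neg, neg_neg, mul_assoc]
  have hv2 : ∀ a : A'', a * (v * v) = v * v * a := by
    refine h_center _ ?_ (mul_assoc _ _ _).symm
    rw [mul_assoc (v : A''), huv, mul_neg, ← mul_assoc, ← mul_assoc (v : A''), huv, neg_mul, neg_neg, mul_assoc]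
  have hd : ∀ a : A'', a * d = d * a := fun a => by
    rw [hd_sq, mul_sub, sub_mul, hu2, hv2]
  have hhd : j h * iota d = -(iota d * j h) := by
    have h_smul : h • (d : A'') = -d := by
      rw [hd_eq, hequi, smul_sub, smul_pow', smul_pow', hu, hv, ← map_neg, neg_sub]
    rw [hT.comm, h_smul, map_neg, neg_mul]
  let c : T'' := iota (f (algebraMap k _ 2⁻¹))
  have hc : 2 * c = 1 := by
    have h_two : (2 : T'') = iota (f (algebraMap k _ 2)) := by simp only [map_ofNat]
    rw [h_two, ← map_mul, ← map_mul, ← map_mul, mul_inv_cancel₀ two_ne_zero]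
    simp only [map_one]
  let ι : A''ˣ →* T''ˣ := Units.map (iota : A'' →* T'')
  have hdR : ∀ a ∈ iota.range, a * (ι d : T'') = ι d * a := by
    rintro _ ⟨a, rfl⟩
    simpa [ι] using congr_arg iota (hd a)
  refine (((hasInnerDualBasis_of_anticommute iota.range c (j h) (ι d) hc hdR hh hhd h_decomp).trans
    (hasInnerDualBasis_of_anticommuting_units iota.range c (ι u) (ι v) hc ⟨_, rfl⟩ ⟨_, rfl⟩
      ⟨_, rfl⟩ ⟨_, rfl⟩ ⟨_, rfl⟩ ?_ ?_ ?_ ?_)).trans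
    (hasInnerDualBasis_center_of_anticommute iota.range c (j h) (ι d) hc hdR hh hhd h_conj
      h_decomp)).isAzumayaAlgebra
  · simpa [ι] using congr_arg iota huv
  · rintro _ ⟨a, rfl⟩
    simpa [ι, mul_assoc] using congr_arg iota (hu2 a).symm
  · rintro _ ⟨a, rfl⟩
    simpa [ι, mul_assoc] using congr_arg iota (hv2 a).symm
  · rintro _ ⟨x, rfl⟩ hux hvx _ ⟨a, rfl⟩
    rw [← map_mul, ← map_mul]
    exact congr_arg iota (h_center x (hT.injective (by simpa [ι] using hux))
      (hT.injective (by simpa [ι] using hvx)) a)
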